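/- In a finite discounted MDP, for any two stationary policies π and π̂, the performance difference identity holds: J(π̂) − J(π) = ∑_s ρ_{π̂}(s) ∑_a π̂(a|s) A_π(s,a), where ρ_{π̂} is the unnormalized discounted state-visitation measure of π̂ and A_π is the advantage function of π. -/

import Mathlib

open Finset

/-- A finite discounted MDP: finite nonempty state set `S`, finite nonempty action set `A`,
transition kernel `P`, bounded reward `r`, discount `γ ∈ [0,1)`, initial distribution `d`. -/
structure MDP (S A : Type) [Fintype S] [Fintype A] where
  P : S → A → S → ℝ
  P_nonneg : ∀ s a s', 0 ≤ P s a s'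
  P_sum_one : ∀ s a, ∑ s', P s a s' = 1
  r : S → A → ℝ
  Rmax : ℝ
  r_bound : ∀ s a, |r s a| ≤ Rmax
  γ : ℝ
  γ_nonneg : 0 ≤ γ
  γ_lt_one : γ < 1
  d : S → ℝ
  d_nonneg : ∀ s, 0 ≤ d s
  d_sum_one : ∑ s, d s = 1

/-- A stationary policy: for each state a probability mass function on actions. -/
structure Policy (S A : Type) [Fintype A] where
  p : S → A → ℝ
  nonneg : ∀ s a, 0 ≤ p s a
  sum_one : ∀ s, ∑ a, p s a = 1

variable {S : Type} [Fintype S] [DecidableEq S] {A : Type} [Fintype A]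

/-- State-transition matrix `M_π(s,s') = ∑_a π(a|s) P(s'|s,a)`. -/
noncomputable def MDP.Mmat (M : MDP S A) (π : Policy S A) : Matrix S S ℝ :=
  Matrix.of fun s s' => ∑ a, π.p s a * M.P s a s'

/-- Expected one-step reward `r_π(s) = ∑_a π(a|s) r(s,a)`. -/
noncomputable def MDP.rvec (M : MDP S A) (π : Policy S A) : S → ℝ :=
  fun s => ∑ a, π.p s a * M.r s a

/-- Value function `V_π(s) = ∑_t γ^t (M_π^t r_π)(s)`. -/
noncomputable def MDP.V (M : MDP S A) (π : Policy S A) (s : S) : ℝ :=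
  ∑' t : ℕ, M.γ ^ t * ((M.Mmat π ^ t).mulVec (M.rvec π)) s

/-- Return `J(π) = ∑_s d(s) V_π(s)`. -/
noncomputable def MDP.J (M : MDP S A) (π : Policy S A) : ℝ :=
  ∑ s, M.d s * M.V π s

/-- Action value `Q_π(s,a) = r(s,a) + γ ∑_{s'} P(s'|s,a) V_π(s')`. -/
noncomputable def MDP.Q (M : MDP S A) (π : Policy S A) (s : S) (a : A) : ℝ :=
  M.r s a + M.γ * ∑ s', M.P s a s' * M.V π s'

/-- Advantage `A_π(s,a) = Q_π(s,a) − V_π(s)`. -/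
noncomputable def MDP.Adv (M : MDP S A) (π : Policy S A) (s : S) (a : A) : ℝ :=
  M.Q π s a - M.V π s

/-- Unnormalized discounted state-visitation measure `ρ_π(s) = ∑_t γ^t (dᵀ M_π^t)(s)`. -/
noncomputable def MDP.rho (M : MDP S A) (π : Policy S A) (s : S) : ℝ :=
  ∑' t : ℕ, M.γ ^ t * Matrix.vecMul M.d (M.Mmat π ^ t) s

/-- KL divergence between two finite pmfs. -/
noncomputable def KLdiv {A : Type} [Fintype A] (μ ν : A → ℝ) : ℝ :=
  ∑ a, μ a * Real.log (μ a / ν a)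

/-- Max conditional KL `D^max_KL(π, π') = max_s KL(π(·|s) ‖ π'(·|s))`. -/
noncomputable def DmaxKL [Nonempty S] (π π' : Policy S A) : ℝ :=
  Finset.univ.sup' Finset.univ_nonempty fun s => KLdiv (π.p s) (π'.p s)

/-- `ε_π = max_{s,a} |A_π(s,a)|`. -/
noncomputable def MDP.eps [Nonempty S] [Nonempty A] (M : MDP S A) (π : Policy S A) : ℝ :=
  Finset.univ.sup' Finset.univ_nonempty fun sa : S × A => |M.Adv π sa.1 sa.2|

/-- Penalty coefficient `C_π = 4 γ ε_π / (1−γ)²`. -/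
noncomputable def MDP.Cpen [Nonempty S] [Nonempty A] (M : MDP S A) (π : Policy S A) : ℝ :=
  4 * M.γ * M.eps π / (1 - M.γ) ^ 2

open Matrix in
/-- The transition matrix of a policy is row stochastic. -/
theorem MDP.Mmat_mem_rowStochastic (M : MDP S A) (π : Policy S A) :
    M.Mmat π ∈ rowStochastic ℝ S := by
  refine mem_rowStochastic_iff_sum.2 ⟨fun s s' => ?_, fun s => ?_⟩
  · exact sum_nonneg fun a _ => mul_nonneg (π.nonneg s a) (M.P_nonneg s a s')
  · simp only [MDP.Mmat, of_apply]
    rw [sum_comm]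
    simp [← mul_sum, M.P_sum_one, π.sum_one]

open Matrix in
/-- The Neumann series of a discounted row stochastic matrix converges. -/
theorem Matrix.summable_smul_pow_of_mem_rowStochastic {B : Matrix S S ℝ}
    (hB : B ∈ rowStochastic ℝ S) {c : ℝ} (hc₀ : 0 ≤ c) (hc₁ : c < 1) :
    Summable fun t : ℕ => (c • B) ^ t := by
  refine Pi.summable.2 fun s => Pi.summable.2 fun s' => ?_
  refine Summable.of_nonneg_of_le (fun t => ?_) (fun t => ?_)
    (summable_geometric_of_lt_one hc₀ hc₁)
  · rw [smul_pow, smul_apply, smul_eq_mul]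
    exact mul_nonneg (pow_nonneg hc₀ t) (nonneg_of_mem_rowStochastic (pow_mem hB t))
  · rw [smul_pow, smul_apply, smul_eq_mul]
    exact mul_le_of_le_one_right (pow_nonneg hc₀ t) (le_one_of_mem_rowStochastic (pow_mem hB t))

/-- The discounted resolvent `∑_t (γ M_π)^t`. -/
noncomputable def MDP.resolvent (M : MDP S A) (π : Policy S A) : Matrix S S ℝ :=
  ∑' t : ℕ, (M.γ • M.Mmat π) ^ t

theorem MDP.hasSum_resolvent (M : MDP S A) (π : Policy S A) :
    HasSum (fun t : ℕ => (M.γ • M.Mmat π) ^ t) (M.resolvent π) :=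
  (Matrix.summable_smul_pow_of_mem_rowStochastic (M.Mmat_mem_rowStochastic π)
    M.γ_nonneg M.γ_lt_one).hasSum

theorem MDP.resolvent_mul_one_sub (M : MDP S A) (π : Policy S A) :
    M.resolvent π * (1 - M.γ • M.Mmat π) = 1 :=
  (M.hasSum_resolvent π).summable.tsum_pow_mul_one_sub

open Matrix in
theorem MDP.V_eq_resolvent_mulVec (M : MDP S A) (π : Policy S A) :
    M.V π = M.resolvent π *ᵥ M.rvec π := by
  funext s
  have h := (M.hasSum_resolvent π).map (mulVec.addMonoidHomLeft (M.rvec π))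
    (continuous_id.matrix_mulVec continuous_const)
  refine ((Pi.hasSum.1 h s).congr_fun ?_).tsum_eq
  intro t
  simp [mulVec.addMonoidHomLeft, smul_pow, smul_mulVec]

open Matrix in
theorem MDP.rho_eq_vecMul_resolvent (M : MDP S A) (π : Policy S A) :
    M.rho π = M.d ᵥ* M.resolvent π := by
  funext s
  have h := (M.hasSum_resolvent π).map
    (⟨⟨fun B => M.d ᵥ* B, vecMul_zero _⟩, fun B C => vecMul_add B C _⟩ :
      Matrix S S ℝ →+ (S → ℝ)) (continuous_const.matrix_vecMul continuous_id)
  refine ((Pi.hasSum.1 h s).congr_fun ?_).tsum_eq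
  intro t
  simp [smul_pow, vecMul_smul]

open Matrix in
/-- The expected advantage of `π` under `π'` is the Bellman residual
`r_{π'} - (1 - γ M_{π'}) V_π`. -/
theorem MDP.sum_mul_Adv (M : MDP S A) (π π' : Policy S A) (s : S) :
    ∑ a, π'.p s a * M.Adv π s a =
      (M.rvec π' - (1 - M.γ • M.Mmat π') *ᵥ M.V π : S → ℝ) s := by
  have hM : (M.Mmat π' *ᵥ M.V π) s = ∑ a, π'.p s a * ∑ s', M.P s a s' * M.V π s' := by
    simp only [mulVec, dotProduct, MDP.Mmat, of_apply, sum_mul, mul_sum, mul_assoc]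
    exact sum_comm
  rw [sub_mulVec, one_mulVec, smul_mulVec, Pi.sub_apply, Pi.sub_apply, Pi.smul_apply, hM,
    smul_eq_mul, mul_sum]
  simp only [MDP.Adv, MDP.Q, MDP.rvec, mul_sub, mul_add, sum_sub_distrib, sum_add_distrib,
    ← sum_mul, π'.sum_one, one_mul, mul_left_comm _ M.γ]
  ring

/-- Performance difference identity:
`J(π̂) − J(π) = ∑_s ρ_{π̂}(s) ∑_a π̂(a|s) A_π(s,a)`. -/
theorem statement4 (M : MDP S A) (π πhat : Policy S A) :
    M.J πhat - M.J π = ∑ s, M.rho πhat s * ∑ a, πhat.p s a * M.Adv π s a := by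
  have h : M.J πhat - M.J π =
      M.rho πhat ⬝ᵥ (M.rvec πhat - (1 - M.γ • M.Mmat πhat).mulVec (M.V π)) := by
    rw [M.rho_eq_vecMul_resolvent, ← Matrix.dotProduct_mulVec, Matrix.mulVec_sub,
      Matrix.mulVec_mulVec, M.resolvent_mul_one_sub, Matrix.one_mulVec,
      ← M.V_eq_resolvent_mulVec, dotProduct_sub]
    rfl
  simp only [h, M.sum_mul_Adv]
  rfl
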